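/- arXiv:1612.05009 — 2 statements merged into one kernel-verified Lean document; each statement's English description precedes it below -/
import Mathlib

section
/- Fix C > 0 and δ ∈ [0, 1/6). Then there exist a constant C' > 0 and an integer k₀ such that for every integer k ≥ k₀ and every θ with C·k^(−δ) < θ < π − C·k^(−δ), one has |P_k(cos θ) − √(2/(π k sin θ)) · cos((k + 1/2)θ − π/4)| ≤ C' · k^(−3/2 + 6δ) · (sin θ)^(−1/2). -/
open Real

/-- The `k`-th Legendre polynomial, via the Rodrigues formula. -/
noncomputable def legendreP (k : ℕ) (x : ℝ) : ℝ :=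
  (1 / (2 ^ k * (Nat.factorial k : ℝ))) * iteratedDeriv k (fun y : ℝ => (y ^ 2 - 1) ^ k) x

open Polynomial in
/-- The Legendre polynomial as an element of `ℝ[X]`. -/
noncomputable def legendrePoly (k : ℕ) : ℝ[X] :=
  C (1 / (2 ^ k * (Nat.factorial k : ℝ))) * derivative^[k] ((X ^ 2 - 1) ^ k)

open Polynomial in
theorem iteratedDeriv_eval_polynomial (p : ℝ[X]) (n : ℕ) :
    iteratedDeriv n (fun x => p.eval x) = fun x => (derivative^[n] p).eval x := by
  induction n with
  | zero => simp
  | succ n ih =>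
    rw [iteratedDeriv_succ, ih, Function.iterate_succ_apply']
    funext x
    exact Polynomial.deriv _

theorem legendreP_eq_eval (k : ℕ) (x : ℝ) : legendreP k x = (legendrePoly k).eval x := by
  have h := congrFun (iteratedDeriv_eval_polynomial ((Polynomial.X ^ 2 - 1) ^ k) k) x
  simp only [Polynomial.eval_pow, Polynomial.eval_sub, Polynomial.eval_X, Polynomial.eval_one] at h
  simp only [legendreP, legendrePoly, h, Polynomial.eval_mul, Polynomial.eval_C]

open Polynomial in
theorem iterate_derivative_legendre_ode (k : ℕ) :
    (derivative^[k + 2] ((X ^ 2 - 1 : ℝ[X]) ^ k)) * (X ^ 2 - 1) +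
      2 * X * derivative^[k + 1] ((X ^ 2 - 1 : ℝ[X]) ^ k) =
    (k * (k + 1) : ℝ[X]) * derivative^[k] ((X ^ 2 - 1 : ℝ[X]) ^ k) := by
  set f : ℝ[X] := (X ^ 2 - 1) ^ k with hf
  have h1 : derivative f * X ^ 2 - derivative f = (2 * k : ℕ) • (f * X) := by
    rcases k with _ | k
    · simp [hf]
    · simp only [hf, derivative_pow, derivative_sub, derivative_one]
      simp [show (C 2 : ℝ[X]) = 2 from rfl]
      ring
  rcases k with _ | k
  · simp [hf, Function.iterate_succ_apply']
  have h2 := congrArg (fun p => derivative^[k + 2] p) h1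
  simp only [iterate_derivative_sub, iterate_derivative_smul, iterate_derivative_mul_X,
    iterate_derivative_mul_X_pow, show min 2 (k + 2) = 2 by omega, Finset.sum_range_succ,
    Finset.sum_range_zero, ← Function.iterate_succ_apply, Nat.choose_two_right,
    show ((k + 2) * (k + 2 - 1) / 2) * Nat.descFactorial 2 2 = (k + 2) * (k + 1) from
      Nat.div_mul_cancel (by rw [mul_comm]; exact Nat.two_dvd_mul_add_one _)] at h2
  simp [-Function.iterate_succ] at h2 ⊢
  linear_combination h2

theorem legendrePoly_ode (k : ℕ) (x : ℝ) :
    (1 - x ^ 2) * (legendrePoly k).derivative.derivative.eval x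
      - 2 * x * (legendrePoly k).derivative.eval x
      + k * (k + 1) * (legendrePoly k).eval x = 0 := by
  have h := congrArg (Polynomial.eval x) (iterate_derivative_legendre_ode k)
  simp only [Function.iterate_succ_apply'] at h
  simp [legendrePoly] at h ⊢
  linear_combination -(1 / (2 ^ k * (Nat.factorial k : ℝ))) * h

open Polynomial in
theorem coeff_X_sq_sub_one_pow (k m : ℕ) :
    ((X ^ 2 - 1 : ℝ[X]) ^ k).coeff (2 * m) = (-1) ^ (k - m) * k.choose m := by
  have : (X ^ 2 - 1 : ℝ[X]) ^ k = expand ℝ 2 ((X + C (-1)) ^ k) := by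
    simp [sub_eq_add_neg]
  rw [this, mul_comm, coeff_expand_mul (by norm_num), coeff_X_add_C_pow]

open Polynomial in
theorem coeff_X_sq_sub_one_pow_odd (k m : ℕ) :
    ((X ^ 2 - 1 : ℝ[X]) ^ k).coeff (2 * m + 1) = 0 := by
  have : (X ^ 2 - 1 : ℝ[X]) ^ k = expand ℝ 2 ((X + C (-1)) ^ k) := by
    simp [sub_eq_add_neg]
  rw [this, coeff_expand (by norm_num), if_neg (by omega)]

theorem eval_zero_legendrePoly (k : ℕ) :
    (legendrePoly k).eval 0 = 1 / 2 ^ k * ((Polynomial.X ^ 2 - 1 : Polynomial ℝ) ^ k).coeff k := by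
  rw [legendrePoly, ← Polynomial.coeff_zero_eq_eval_zero, Polynomial.coeff_C_mul,
    Polynomial.coeff_iterate_derivative, zero_add, Nat.descFactorial_self, nsmul_eq_mul]
  field_simp

theorem eval_zero_derivative_legendrePoly (k : ℕ) :
    (legendrePoly k).derivative.eval 0 =
      (k + 1) / 2 ^ k * ((Polynomial.X ^ 2 - 1 : Polynomial ℝ) ^ k).coeff (k + 1) := by
  rw [← Polynomial.coeff_zero_eq_eval_zero, Polynomial.coeff_derivative, legendrePoly,
    Polynomial.coeff_C_mul, Polynomial.coeff_iterate_derivative, zero_add, add_comm 1 k,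
    Nat.descFactorial_eq_div (by omega), show k + 1 - k = 1 by omega, Nat.factorial_one,
    Nat.div_one, Nat.factorial_succ, nsmul_eq_mul]
  push_cast
  field_simp
  simp

/-- The scaled central binomial coefficient, given by Wallis' product. -/
theorem centralBinom_div_sq (m : ℕ) :
    ((m.centralBinom : ℝ) / 4 ^ m) ^ 2 = 1 / ((2 * m + 1) * Real.Wallis.W m) := by
  rw [Real.Wallis.W_eq_factorial_ratio, Nat.centralBinom, Nat.cast_choose ℝ (by omega : m ≤ 2 * m),
    show 2 * m - m = m by omega, show (4 : ℝ) ^ m = 2 ^ (2 * m) by rw [pow_mul]; norm_num]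
  field_simp
  ring

theorem legendrePoly_even (m : ℕ) :
    (legendrePoly (2 * m)).eval 0 = (-1) ^ m * (m.centralBinom / 4 ^ m) ∧
    (legendrePoly (2 * m)).derivative.eval 0 = 0 := by
  constructor
  · rw [eval_zero_legendrePoly, coeff_X_sq_sub_one_pow, pow_mul, Nat.centralBinom,
      show 2 * m - m = m by omega]
    norm_num
    ring
  · rw [eval_zero_derivative_legendrePoly, coeff_X_sq_sub_one_pow_odd, mul_zero]

theorem legendrePoly_odd (m : ℕ) :
    (legendrePoly (2 * m + 1)).eval 0 = 0 ∧
    (legendrePoly (2 * m + 1)).derivative.eval 0 =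
      (2 * m + 1) * ((-1) ^ m * (m.centralBinom / 4 ^ m)) := by
  constructor
  · rw [eval_zero_legendrePoly, coeff_X_sq_sub_one_pow_odd, mul_zero]
  · rw [eval_zero_derivative_legendrePoly, show 2 * m + 1 + 1 = 2 * (m + 1) by ring,
      coeff_X_sq_sub_one_pow, show 2 * m + 1 - (m + 1) = m by omega]
    have h : ((m + 1) * (2 * m + 1).choose (m + 1) : ℕ) = (2 * m + 1) * m.centralBinom := by
      have := Nat.add_one_mul_choose_eq (2 * m) m
      rw [Nat.centralBinom]
      linarith
    have hcast : ((m : ℝ) + 1) * (2 * m + 1).choose (m + 1) = (2 * m + 1) * m.centralBinom := by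
      exact_mod_cast h
    rw [pow_succ, pow_mul]
    norm_num
    field_simp
    linear_combination 2 * hcast

theorem norm_sub_le_of_norm_deriv_le {z z' : ℝ → ℂ} {K T : ℝ} (hK : 0 < K) (hT : 0 ≤ T)
    (hz : ∀ t ∈ Set.Icc 0 T, HasDerivAt z (z' t) t)
    (hb : ∀ t ∈ Set.Icc 0 T, ‖z' t‖ ≤ K * ‖z t‖) :
    ‖z T - z 0‖ ≤ ‖z 0‖ * (K * T * exp (K * T)) := by
  have h := norm_le_gronwallBound_of_norm_deriv_right_le (f := fun t => z t - z 0) (f' := z')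
    (δ := 0) (K := K) (ε := K * ‖z 0‖) (a := 0) (b := T)
    (fun t ht => ((hz t ht).continuousAt.sub continuousAt_const).continuousWithinAt)
    (fun t ht => ((hz t ⟨ht.1, ht.2.le⟩).sub_const _).hasDerivWithinAt) (by simp)
    (fun t ht => (hb t ⟨ht.1, ht.2.le⟩).trans (by
      rw [← mul_add]
      gcongr
      simpa using norm_add_le (z t - z 0) (z 0))) T ⟨hT, le_rfl⟩
  rw [gronwallBound_of_K_ne_0 hK.ne'] at h
  simp only [sub_zero, zero_mul, zero_add, mul_div_cancel_left₀ _ hK.ne'] at h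
  refine h.trans ?_
  gcongr
  have h1 := add_one_le_exp (-(K * T))
  have h2 := exp_pos (K * T)
  have h3 : exp (-(K * T)) * exp (K * T) = 1 := by rw [← exp_add]; simp
  nlinarith

/-- The Liouville transform `√(sin θ) p(cos θ)` of a polynomial `p`. -/
noncomputable def liouville (p : Polynomial ℝ) (θ : ℝ) : ℝ :=
  √(sin θ) * p.eval (cos θ)

/-- The derivative of the Liouville transform. -/
noncomputable def liouvilleDeriv (p : Polynomial ℝ) (θ : ℝ) : ℝ :=
  cos θ / (2 * √(sin θ)) * p.eval (cos θ) - √(sin θ) ^ 3 * p.derivative.eval (cos θ)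

theorem hasDerivAt_liouville (p : Polynomial ℝ) {θ : ℝ} (h : 0 < sin θ) :
    HasDerivAt (liouville p) (liouvilleDeriv p θ) θ := by
  have h1 := ((hasDerivAt_sin θ).sqrt h.ne').mul ((p.hasDerivAt (cos θ)).comp θ (hasDerivAt_cos θ))
  refine h1.congr_deriv ?_
  have : √(sin θ) ^ 2 = sin θ := sq_sqrt h.le
  simp only [liouvilleDeriv, Function.comp]
  linear_combination (√(sin θ) * p.derivative.eval (cos θ)) * this

theorem hasDerivAt_liouvilleDeriv {p : Polynomial ℝ} {μ θ : ℝ} (h : 0 < sin θ)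
    (hp : ∀ x : ℝ, (1 - x ^ 2) * p.derivative.derivative.eval x - 2 * x * p.derivative.eval x
      + (μ ^ 2 - 1 / 4) * p.eval x = 0) :
    HasDerivAt (liouvilleDeriv p) (-(μ ^ 2 + 1 / (4 * sin θ ^ 2)) * liouville p θ) θ := by
  have hr := (hasDerivAt_sin θ).sqrt h.ne'
  have hr0 : 0 < √(sin θ) := sqrt_pos.2 h
  have h1 := (((hasDerivAt_cos θ).div (hr.const_mul 2) (by positivity)).mul
    ((p.hasDerivAt (cos θ)).comp θ (hasDerivAt_cos θ))).sub ((hr.pow 3).mul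
    ((p.derivative.hasDerivAt (cos θ)).comp θ (hasDerivAt_cos θ)))
  refine h1.congr_deriv ?_
  have h2 : √(sin θ) ^ 2 = sin θ := sq_sqrt h.le
  have h3 := sin_sq_add_cos_sq θ
  have h4 := hp (cos θ)
  simp only [liouville, Function.comp, Pi.pow_apply, Pi.div_apply]
  generalize √(sin θ) = r at *
  rw [← h2] at h3 ⊢
  have h5 : (1 - cos θ ^ 2) = r ^ 4 := by linear_combination -h3
  rw [h5] at h4
  have h6 : cos θ ^ 2 = 1 - r ^ 4 := by linear_combination -h5
  field_simp
  push_cast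
  linear_combination 16 * r ^ 4 * h4 - 4 * p.eval (cos θ) * h6

open Complex in
theorem hasDerivAt_rotating_frame {u v : ℝ → ℝ} {μ w a θ : ℝ} (hu : HasDerivAt u (v θ) θ)
    (hv : HasDerivAt v (-(μ ^ 2 + w) * u θ) θ) :
    HasDerivAt (fun t : ℝ => cexp (-(I * μ * (t - a : ℝ))) * (v t + I * μ * u t))
      (-(cexp (-(I * μ * (θ - a : ℝ))) * (w * u θ))) θ := by
  have h1 : HasDerivAt (fun t : ℝ => -(I * μ * (t - a : ℝ))) (-(I * μ * (1 : ℝ))) θ :=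
    ((((hasDerivAt_id θ).sub_const a).ofReal_comp).const_mul _).neg
  refine (h1.cexp.mul (hv.ofReal_comp.add (hu.ofReal_comp.const_mul (I * μ)))).congr_deriv ?_
  push_cast
  simp only [Pi.add_apply]
  linear_combination (-cexp (-(I * μ * (θ - a))) * μ ^ 2 * u θ) * I_sq

open Complex in
theorem liouville_close {p : Polynomial ℝ} {μ θ : ℝ} (hμ : 0 < μ) (h0 : 0 < θ) (hπ : θ < π)
    (hp : ∀ x : ℝ, (1 - x ^ 2) * p.derivative.derivative.eval x - 2 * x * p.derivative.eval x
      + (μ ^ 2 - 1 / 4) * p.eval x = 0) :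
    |μ * liouville p θ - (μ * p.eval 0 * Real.cos (μ * (θ - π / 2))
      - p.derivative.eval 0 * Real.sin (μ * (θ - π / 2)))| ≤
    √(p.derivative.eval 0 ^ 2 + (μ * p.eval 0) ^ 2) *
      (1 / (4 * μ * Real.sin θ ^ 2) * |θ - π / 2| *
        Real.exp (1 / (4 * μ * Real.sin θ ^ 2) * |θ - π / 2|)) := by
  have hs : 0 < Real.sin θ := Real.sin_pos_of_pos_of_lt_pi h0 hπ
  obtain ⟨ε, hε, hεT⟩ : ∃ ε : ℝ, (ε = 1 ∨ ε = -1) ∧ ε * |θ - π / 2| = θ - π / 2 := by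
    rcases abs_cases (θ - π / 2) with h | h
    · exact ⟨1, Or.inl rfl, by rw [h.1, one_mul]⟩
    · exact ⟨-1, Or.inr rfl, by rw [h.1]; ring⟩
  set T := |θ - π / 2| with hT
  have hT2 : T < π / 2 := abs_lt.2 ⟨by linarith, by linarith⟩
  have hsin : ∀ t, Real.sin (π / 2 + ε * t) = Real.cos t := by
    intro t
    rcases hε with rfl | rfl
    · rw [one_mul, add_comm, Real.sin_add_pi_div_two]
    · rw [neg_one_mul, ← sub_eq_add_neg, Real.sin_pi_div_two_sub]
  have hθ : θ = π / 2 + ε * T := by rw [hεT]; ring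
  have hsθ : Real.sin θ = Real.cos T := by rw [hθ, hsin]
  have hle : ∀ t ∈ Set.Icc 0 T, Real.sin θ ≤ Real.sin (π / 2 + ε * t) := by
    intro t ht
    rw [hsθ, hsin]
    exact Real.cos_le_cos_of_nonneg_of_le_pi ht.1 (by linarith [Real.pi_pos]) ht.2
  set Z : ℝ → ℂ := fun t => cexp (-(I * μ * (t - π / 2 : ℝ))) *
    (liouvilleDeriv p t + I * μ * liouville p t) with hZ
  have hre : ∀ t : ℝ, ‖cexp (-(I * μ * (t - π / 2 : ℝ)))‖ = 1 := by
    intro t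
    rw [Complex.norm_exp]
    simp
  have hnormsq : ∀ x y : ℝ, ‖(x : ℂ) + I * μ * y‖ = √(x ^ 2 + (μ * y) ^ 2) := by
    intro x y
    rw [Complex.norm_eq_sqrt_sq_add_sq]
    simp
  have hnorm : ∀ t, μ * |liouville p t| ≤ ‖Z t‖ := by
    intro t
    rw [hZ]
    simp only [norm_mul, hre, one_mul, hnormsq]
    rw [← abs_of_pos hμ, ← abs_mul, abs_of_pos hμ]
    exact Real.abs_le_sqrt (by nlinarith [sq_nonneg (liouvilleDeriv p t)])
  have hmain := norm_sub_le_of_norm_deriv_le (z := fun t => Z (π / 2 + ε * t))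
    (z' := fun t => ε • (-(cexp (-(I * μ * ((π / 2 + ε * t) - π / 2 : ℝ))) *
      (((1 / (4 * Real.sin (π / 2 + ε * t) ^ 2) : ℝ) : ℂ) * liouville p (π / 2 + ε * t)))))
    (K := 1 / (4 * μ * Real.sin θ ^ 2)) (T := T) (by positivity) (abs_nonneg _)
    (fun t ht => by
      have h1 : HasDerivAt (fun t : ℝ => π / 2 + ε * t) ε t := by
        simpa using ((hasDerivAt_id t).const_mul ε).const_add (π / 2)
      have hpos : 0 < Real.sin (π / 2 + ε * t) := hs.trans_le (hle t ht)
      exact (hasDerivAt_rotating_frame (a := π / 2) (hasDerivAt_liouville p hpos)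
        (hasDerivAt_liouvilleDeriv hpos hp)).scomp t h1)
    (fun t ht => by
      have hpos : 0 < Real.sin (π / 2 + ε * t) := hs.trans_le (hle t ht)
      have hε1 : ‖ε‖ = 1 := by rcases hε with rfl | rfl <;> simp
      simp only [norm_smul, hε1, one_mul, norm_neg, norm_mul, hre, Complex.norm_real]
      rw [Real.norm_eq_abs, Real.norm_eq_abs, abs_of_pos (by positivity)]
      have h2 := hnorm (π / 2 + ε * t)
      have h3 : 1 / (4 * Real.sin (π / 2 + ε * t) ^ 2) ≤ 1 / (4 * Real.sin θ ^ 2) := by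
        have := hle t ht
        gcongr
      calc _ ≤ 1 / (4 * Real.sin θ ^ 2) * |liouville p (π / 2 + ε * t)| := by gcongr
        _ = 1 / (4 * μ * Real.sin θ ^ 2) * (μ * |liouville p (π / 2 + ε * t)|) := by field_simp
        _ ≤ _ := by gcongr)
  simp only [mul_zero, add_zero, ← hθ] at hmain
  have hZ0 : Z (π / 2) = ((-p.derivative.eval 0 : ℝ) : ℂ) + I * μ * (p.eval 0 : ℝ) := by
    simp [hZ, liouville, liouvilleDeriv]
  have hZ0n : ‖Z (π / 2)‖ = √(p.derivative.eval 0 ^ 2 + (μ * p.eval 0) ^ 2) := by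
    rw [hZ0, hnormsq, neg_sq]
  rw [hZ0n] at hmain
  refine le_trans ?_ hmain
  have him : μ * liouville p θ - (μ * p.eval 0 * Real.cos (μ * (θ - π / 2))
      - p.derivative.eval 0 * Real.sin (μ * (θ - π / 2))) =
      (cexp ((μ * (θ - π / 2) : ℝ) * I) * (Z θ - Z (π / 2))).im := by
    have h4 : cexp ((μ * (θ - π / 2) : ℝ) * I) * Z θ =
        liouvilleDeriv p θ + I * μ * liouville p θ := by
      rw [hZ]
      simp only
      rw [← mul_assoc, ← Complex.exp_add]
      convert one_mul _
      rw [Complex.exp_eq_one_iff]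
      exact ⟨0, by push_cast; ring⟩
    rw [mul_sub (cexp _), h4, hZ0]
    generalize μ * (θ - π / 2) = φ
    simp [Complex.exp_ofReal_mul_I_re, Complex.exp_ofReal_mul_I_im]
    ring
  rw [him]
  refine (Complex.abs_im_le_norm _).trans ?_
  rw [norm_mul, Complex.norm_exp_ofReal_mul_I, one_mul]

theorem centralBinom_div_sq_bounds (m : ℕ) :
    ∃ g : ℝ, ((m.centralBinom : ℝ) / 4 ^ m) ^ 2 = 2 / π * g ∧
      1 / (2 * m + 1) ≤ g ∧ g ≤ (2 * m + 2) / (2 * m + 1) ^ 2 := by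
  have h1 := Real.Wallis.W_le m
  have h2 := Real.Wallis.le_W m
  have hW := Real.Wallis.W_pos m
  have hpi := pi_pos
  refine ⟨π / 2 * (1 / ((2 * m + 1) * Real.Wallis.W m)), ?_, ?_, ?_⟩
  · rw [centralBinom_div_sq]
    field_simp
  · rw [mul_one_div, div_le_div_iff₀ (by positivity) (by positivity)]
    nlinarith [mul_le_mul_of_nonneg_left h1 (by positivity : (0 : ℝ) ≤ 2 * m + 1)]
  · rw [mul_one_div, div_le_div_iff₀ (by positivity) (by positivity)]
    rw [div_mul_eq_mul_div, div_le_iff₀ (by positivity)] at h2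
    nlinarith [mul_le_mul_of_nonneg_left h2 (by positivity : (0 : ℝ) ≤ 2 * m + 1)]

theorem abs_sub_two_div_pi_mul_le {a g x : ℝ} (hx : 0 < x) (ha : a = 2 / π * g)
    (hl : 1 / x - 1 / x ^ 2 ≤ g) (hu : g ≤ 1 / x + 1 / x ^ 2) :
    |a - 2 / (π * x)| ≤ 1 / x ^ 2 := by
  have hpi : 2 / π ≤ 1 := (div_le_one pi_pos).2 (by linarith [pi_gt_three])
  have h0 : 0 ≤ 2 / π := by have := pi_pos; positivity
  have h1 : a - 2 / (π * x) = 2 / π * (g - 1 / x) := by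
    rw [ha]; field_simp
  rw [h1, abs_mul, abs_of_nonneg h0]
  exact (mul_le_of_le_one_left (abs_nonneg _) hpi).trans
    (abs_le.2 ⟨by linarith, by linarith⟩)

theorem legendrePoly_amplitude {k : ℕ} (hk : 1 ≤ k) :
    ∃ A : ℝ, 0 ≤ A ∧ |A ^ 2 - 2 / (π * k)| ≤ 1 / (k : ℝ) ^ 2 ∧
      √((legendrePoly k).derivative.eval 0 ^ 2 + ((k + 1 / 2 : ℝ) * (legendrePoly k).eval 0) ^ 2) =
        (k + 1 / 2) * A ∧
      ∀ θ : ℝ, (k + 1 / 2 : ℝ) * (legendrePoly k).eval 0 * cos ((k + 1 / 2 : ℝ) * (θ - π / 2)) -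
        (legendrePoly k).derivative.eval 0 * sin ((k + 1 / 2 : ℝ) * (θ - π / 2)) =
        (k + 1 / 2) * A * cos ((k + 1 / 2 : ℝ) * θ - π / 4) := by
  have hk0 : (1 : ℝ) ≤ k := by exact_mod_cast hk
  obtain ⟨m, rfl | rfl⟩ := k.even_or_odd'
  · obtain ⟨h0, h1⟩ := legendrePoly_even m
    obtain ⟨g, hg, hl, hu⟩ := centralBinom_div_sq_bounds m
    rw [h0, h1]
    have hw : (0 : ℝ) ≤ m.centralBinom / 4 ^ m := by positivity
    generalize (m.centralBinom : ℝ) / 4 ^ m = w at *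
    push_cast at hk0 ⊢
    refine ⟨w, hw, abs_sub_two_div_pi_mul_le (by linarith) hg (le_trans ?_ hl) (hu.trans ?_),
      ?_, fun θ => ?_⟩
    · generalize 2 * (m : ℝ) = x at *
      rw [div_sub_div _ _ (by positivity) (by positivity), div_le_div_iff₀ (by positivity) (by positivity)]
      nlinarith
    · generalize 2 * (m : ℝ) = x at *
      rw [div_add_div _ _ (by positivity) (by positivity), div_le_div_iff₀ (by positivity) (by positivity)]
      have : 0 ≤ x := by linarith
      have : 0 ≤ x ^ 2 := by positivity
      have : 0 ≤ x ^ 3 := by positivity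
      nlinarith
    · rw [zero_pow two_ne_zero, zero_add, Real.sqrt_sq_eq_abs, abs_mul, abs_mul, abs_pow, abs_neg,
        abs_one, one_pow, one_mul, abs_of_nonneg hw, abs_of_nonneg (by positivity)]
    · have h2 : (2 * m + 1 / 2 : ℝ) * (θ - π / 2) = ((2 * m + 1 / 2) * θ - π / 4) - m * π := by ring
      rw [h2, cos_sub_nat_mul_pi]
      have h3 : ((-1 : ℝ) ^ m) * (-1) ^ m = 1 := by rw [← mul_pow]; norm_num
      linear_combination (2 * m + 1 / 2 : ℝ) * w * cos ((2 * m + 1 / 2) * θ - π / 4) * h3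
  · obtain ⟨h0, h1⟩ := legendrePoly_odd m
    obtain ⟨g, hg, hl, hu⟩ := centralBinom_div_sq_bounds m
    rw [h0, h1]
    have hw : (0 : ℝ) ≤ m.centralBinom / 4 ^ m := by positivity
    generalize (m.centralBinom : ℝ) / 4 ^ m = w at *
    push_cast at hk0 ⊢
    refine ⟨(2 * m + 1) / (2 * m + 1 + 1 / 2) * w, by positivity,
      abs_sub_two_div_pi_mul_le (g := ((2 * m + 1) / (2 * m + 1 + 1 / 2)) ^ 2 * g) (by linarith)
        (by rw [mul_pow, hg]; ring) ?_ ?_, ?_, fun θ => ?_⟩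
    · refine le_trans ?_ (mul_le_mul_of_nonneg_left hl (by positivity))
      generalize 2 * (m : ℝ) + 1 = x at *
      rw [div_sub_div _ _ (by positivity) (by positivity), div_pow, div_mul_div_comm,
        div_le_div_iff₀ (by positivity) (by positivity)]
      have h1 : (1 * x ^ 2 - x * 1) * ((x + 1 / 2) ^ 2 * x) + x ^ 2 * (3 * x / 4 + 1 / 4) =
        x ^ 2 * 1 * (x * x ^ 2) := by ring
      have : 0 ≤ x ^ 2 * (3 * x / 4 + 1 / 4) := by positivity
      linarith
    · refine (mul_le_mul_of_nonneg_left hu (by positivity)).trans ?_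
      rw [show (2 * m + 2 : ℝ) = 2 * m + 1 + 1 by ring]
      generalize 2 * (m : ℝ) + 1 = x at *
      have h1 : (x / (x + 1 / 2)) ^ 2 * ((x + 1) / x ^ 2) ≤ 1 / x := by
        rw [div_pow, div_mul_div_comm, div_le_div_iff₀ (by positivity) (by positivity)]
        have : 0 ≤ x ^ 2 := by positivity
        nlinarith
      have : 0 ≤ 1 / x ^ 2 := by positivity
      linarith
    · rw [mul_zero, zero_pow two_ne_zero, add_zero, Real.sqrt_sq_eq_abs, abs_mul, abs_mul, abs_pow,
        abs_neg, abs_one, one_pow, one_mul, abs_of_nonneg hw, abs_of_nonneg (by positivity)]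
      field_simp
    · have h2 : (2 * m + 1 + 1 / 2 : ℝ) * (θ - π / 2) =
          (((2 * m + 1 + 1 / 2) * θ - π / 4) - m * π) - π / 2 := by ring
      have h3 : ((-1 : ℝ) ^ m) * (-1) ^ m = 1 := by rw [← mul_pow]; norm_num
      rw [h2, sin_sub_pi_div_two, cos_sub_nat_mul_pi]
      generalize cos ((2 * m + 1 + 1 / 2) * θ - π / 4) = c
      field_simp
      linear_combination 2 * (2 * m + 1 : ℝ) * w * c * h3

/-- Replacing the exact amplitude by its leading asymptotics. -/
theorem abs_sub_sqrt_le {A x : ℝ} (hA : 0 ≤ A) (hx : 1 ≤ x)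
    (h : |A ^ 2 - 2 / (π * x)| ≤ 1 / x ^ 2) :
    |A - √(2 / (π * x))| ≤ 2 * x ^ (-(3 : ℝ) / 2) ∧ A ≤ 2 * x ^ (-(1 : ℝ) / 2) := by
  have hx0 : 0 < x := by linarith
  have hpi := pi_gt_three
  have hpi4 := pi_le_four
  set y := x ^ (-(1 : ℝ) / 2) with hy
  have hy0 : 0 < y := rpow_pos_of_pos hx0 _
  have hy2 : y ^ 2 = 1 / x := by
    rw [hy, ← rpow_natCast, ← rpow_mul hx0.le, one_div, ← rpow_neg_one]
    norm_num
  have hy3 : x ^ (-(3 : ℝ) / 2) = y ^ 3 := by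
    rw [hy, ← rpow_natCast, ← rpow_mul hx0.le]
    norm_num
  have hy1 : y ≤ 1 := rpow_le_one_of_one_le_of_nonpos hx (by norm_num)
  set a := √(2 / (π * x)) with ha
  have ha2 : a ^ 2 = 2 / π * y ^ 2 := by
    rw [ha, sq_sqrt (by positivity), hy2]; field_simp
  have hlow : 1 / 2 ≤ 2 / π := by
    rw [div_le_div_iff₀ (by norm_num) (by positivity)]; linarith
  have hup : 2 / π ≤ 1 := (div_le_one pi_pos).2 (by linarith)
  have hay : y / 2 ≤ a := by
    refine abs_le_of_sq_le_sq' ?_ (sqrt_nonneg _) |>.2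
    rw [ha2]; nlinarith [sq_nonneg y]
  have h4 : 1 / x ^ 2 = y ^ 4 := by
    rw [show y ^ 4 = (y ^ 2) ^ 2 by ring, hy2]; ring
  have h5 : 2 / (π * x) = a ^ 2 := (sq_sqrt (by positivity)).symm
  rw [h4, h5] at h
  rw [hy3]
  constructor
  · have h6 : |A - a| * (A + a) ≤ y ^ 4 := by
      rw [← abs_of_nonneg (by positivity : 0 ≤ A + a), ← abs_mul,
        show (A - a) * (A + a) = A ^ 2 - a ^ 2 by ring]
      exact h
    have h7 : |A - a| * (y / 2) ≤ y ^ 4 :=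
      (mul_le_mul_of_nonneg_left (by linarith) (abs_nonneg _)).trans h6
    refine le_of_mul_le_mul_right ?_ (half_pos hy0)
    linarith
  · refine abs_le_of_sq_le_sq' ?_ (by positivity) |>.2
    have h8 := (abs_le.1 h).2
    have h9 : y ^ 4 ≤ y ^ 2 := pow_le_pow_of_le_one hy0.le hy1 (by norm_num)
    nlinarith [sq_nonneg y]

theorem mul_rpow_le_sin {C δ θ : ℝ} {k : ℕ} (h1 : C * (k : ℝ) ^ (-δ) < θ)
    (h2 : θ < π - C * (k : ℝ) ^ (-δ)) (hC : 0 < C) :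
    2 / π * (C * (k : ℝ) ^ (-δ)) ≤ sin θ := by
  have h0 : 0 ≤ C * (k : ℝ) ^ (-δ) := by positivity
  have hpi : 0 < 2 / π := by have := pi_pos; positivity
  rcases le_total θ (π / 2) with h | h
  · exact (mul_le_mul_of_nonneg_left h1.le hpi.le).trans (mul_le_sin (by linarith) h)
  · rw [← sin_pi_sub]
    exact (mul_le_mul_of_nonneg_left (by linarith) hpi.le).trans
      (mul_le_sin (by linarith) (by linarith))

theorem laplace_asymptotics_legendre (C δ : ℝ) (hC : 0 < C) (hδ0 : 0 ≤ δ) (hδ1 : δ < 1 / 6) :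
    ∃ (C' : ℝ) (k₀ : ℕ), 0 < C' ∧ ∀ k : ℕ, k₀ ≤ k → ∀ θ : ℝ,
      C * (k : ℝ) ^ (-δ) < θ → θ < Real.pi - C * (k : ℝ) ^ (-δ) →
      |legendreP k (Real.cos θ) -
          Real.sqrt (2 / (Real.pi * k * Real.sin θ)) *
            Real.cos (((k : ℝ) + 1 / 2) * θ - Real.pi / 4)| ≤
        C' * (k : ℝ) ^ (-(3 : ℝ) / 2 + 6 * δ) * Real.sin θ ^ (-(1 : ℝ) / 2) := by
  have hpi := pi_pos
  set D : ℝ := π ^ 2 / (8 * C ^ 2) with hD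
  have hD0 : 0 < D := by positivity
  refine ⟨2 * D * exp D + 2, 1, by positivity, fun k hk θ h1 h2 => ?_⟩
  have hk1 : (1 : ℝ) ≤ k := by exact_mod_cast hk
  have hk0 : (0 : ℝ) < k := by linarith
  have hsin := mul_rpow_le_sin h1 h2 hC
  have hCk : 0 < C * (k : ℝ) ^ (-δ) := by positivity
  have hs : 0 < sin θ := lt_of_lt_of_le (by positivity) hsin
  obtain ⟨A, hA, hA2, hnorm, hmain⟩ := legendrePoly_amplitude hk
  obtain ⟨hAsub, hAle⟩ := abs_sub_sqrt_le hA hk1 hA2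
  have hμ : (0 : ℝ) < k + 1 / 2 := by positivity
  have hclose := liouville_close (p := legendrePoly k) hμ (by linarith) (by linarith)
    (fun x => by linear_combination legendrePoly_ode k x) (θ := θ)
  rw [hnorm, hmain] at hclose
  have hE : 1 / (4 * (k + 1 / 2 : ℝ) * sin θ ^ 2) * |θ - π / 2| ≤ D * (k : ℝ) ^ (2 * δ - 1) := by
    have hT : |θ - π / 2| ≤ 2 := abs_le.2 ⟨by linarith [pi_le_four], by linarith [pi_le_four]⟩
    have hden : 4 * (k : ℝ) * (2 / π * (C * (k : ℝ) ^ (-δ))) ^ 2 ≤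
        4 * (k + 1 / 2 : ℝ) * sin θ ^ 2 := by gcongr; linarith
    have hpow : (k : ℝ) ^ (2 * δ - 1) * ((k : ℝ) * ((k : ℝ) ^ (-δ)) ^ 2) = 1 := by
      rw [← rpow_natCast, ← rpow_mul hk0.le, ← rpow_one_add' hk0.le, ← rpow_add hk0]
      · convert rpow_zero _ using 2; push_cast; ring
      · push_cast; linarith
    calc _ ≤ 1 / (4 * (k : ℝ) * (2 / π * (C * (k : ℝ) ^ (-δ))) ^ 2) * 2 := by gcongr
      _ = D * (k : ℝ) ^ (2 * δ - 1) := by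
        rw [hD]
        field_simp
        linear_combination (-8 : ℝ) * hpow
  have hkle : (k : ℝ) ^ (2 * δ - 1) ≤ 1 := rpow_le_one_of_one_le_of_nonpos hk1 (by linarith)
  have hu : |liouville (legendrePoly k) θ - A * cos ((k + 1 / 2 : ℝ) * θ - π / 4)| ≤
      A * (D * (k : ℝ) ^ (2 * δ - 1) * exp D) := by
    rw [mul_assoc (k + 1 / 2 : ℝ), ← mul_sub, abs_mul, abs_of_pos hμ, mul_assoc] at hclose
    refine (le_of_mul_le_mul_left hclose hμ).trans ?_
    gcongr
    exact hE.trans (mul_le_of_le_one_right hD0.le hkle)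
  set a := √(2 / (π * k)) with ha
  set c := cos ((k + 1 / 2 : ℝ) * θ - π / 4) with hc
  have hexp1 : (k : ℝ) ^ (-(1 : ℝ) / 2) * (k : ℝ) ^ (2 * δ - 1) ≤
      (k : ℝ) ^ (-(3 : ℝ) / 2 + 6 * δ) := by
    rw [← rpow_add hk0]
    exact rpow_le_rpow_of_exponent_le hk1 (by linarith)
  have hexp2 : (k : ℝ) ^ (-(3 : ℝ) / 2) ≤ (k : ℝ) ^ (-(3 : ℝ) / 2 + 6 * δ) :=
    rpow_le_rpow_of_exponent_le hk1 (by linarith)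
  have hfin : |liouville (legendrePoly k) θ - a * c| ≤
      (2 * D * exp D + 2) * (k : ℝ) ^ (-(3 : ℝ) / 2 + 6 * δ) := by
    have h3 : |(A - a) * c| ≤ 2 * (k : ℝ) ^ (-(3 : ℝ) / 2) := by
      rw [abs_mul]
      exact (mul_le_of_le_one_right (abs_nonneg _) (abs_cos_le_one _)).trans hAsub
    calc _ = |(liouville (legendrePoly k) θ - A * c) + (A - a) * c| := by congr 1; ring
      _ ≤ A * (D * (k : ℝ) ^ (2 * δ - 1) * exp D) + 2 * (k : ℝ) ^ (-(3 : ℝ) / 2) :=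
        (abs_add_le _ _).trans (add_le_add hu h3)
      _ ≤ 2 * (k : ℝ) ^ (-(1 : ℝ) / 2) * (D * (k : ℝ) ^ (2 * δ - 1) * exp D) +
          2 * (k : ℝ) ^ (-(3 : ℝ) / 2 + 6 * δ) := by gcongr
      _ = 2 * D * exp D * ((k : ℝ) ^ (-(1 : ℝ) / 2) * (k : ℝ) ^ (2 * δ - 1)) +
          2 * (k : ℝ) ^ (-(3 : ℝ) / 2 + 6 * δ) := by ring
      _ ≤ 2 * D * exp D * (k : ℝ) ^ (-(3 : ℝ) / 2 + 6 * δ) +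
          2 * (k : ℝ) ^ (-(3 : ℝ) / 2 + 6 * δ) := by gcongr
      _ = _ := by ring
  have hr : sin θ ^ (-(1 : ℝ) / 2) = (√(sin θ))⁻¹ := by
    rw [neg_div, rpow_neg hs.le, sqrt_eq_rpow]
  have hsplit : √(2 / (π * k * sin θ)) = a * (√(sin θ))⁻¹ := by
    rw [← div_div, sqrt_div' _ hs.le, div_eq_mul_inv]
  have hr0 : 0 < √(sin θ) := sqrt_pos.2 hs
  have heq : legendreP k (cos θ) - √(2 / (π * k * sin θ)) * c =
      (liouville (legendrePoly k) θ - a * c) * (√(sin θ))⁻¹ := by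
    rw [hsplit, legendreP_eq_eval, liouville]
    field_simp
  rw [heq, hr, abs_mul, abs_of_pos (inv_pos.2 hr0)]
  gcongr
end

section
/- Let n ≥ 1 be an integer and set α = n/2 − 1. Fix C > 0 and δ ∈ [0, 1/6). Then there exist C' > 0 and an integer k₀ such that for every integer k ≥ k₀ and every θ with C·k^(−δ) < θ < π − C·k^(−δ), one has |P_k^(α,α)(cos θ) − (π k)^(−1/2) · (cos(θ/2) sin(θ/2))^(−(n−1)/2) · cos(kθ + (θ/2 − π/4)(n−1))| ≤ C' · k^(−3/2 + 6δ) · (sin θ)^(−(n−1)/2). -/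
open Real

/-- The Jacobi polynomial `P_k^{(α,β)}`, via the Rodrigues formula (real powers). -/
noncomputable def jacobiP (α β : ℝ) (k : ℕ) (x : ℝ) : ℝ :=
  ((-1 : ℝ) ^ k / (2 ^ k * (Nat.factorial k : ℝ))) * (1 - x) ^ (-α) * (1 + x) ^ (-β) *
    iteratedDeriv k (fun y : ℝ => (1 - y) ^ (α + k) * (1 + y) ^ (β + k)) x

/-- The base function of the symmetric Rodrigues formula. -/
noncomputable def rodriguesWeight (s : ℝ) (y : ℝ) : ℝ := (1 - y) ^ s * (1 + y) ^ s

theorem analyticAt_rodriguesWeight (s : ℝ) {x : ℝ} (hx : x ∈ Set.Ioo (-1 : ℝ) 1) :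
    AnalyticAt ℝ (rodriguesWeight s) x := by
  unfold rodriguesWeight
  have h1 : 0 < 1 - x := by linarith [hx.2]
  have h2 : 0 < 1 + x := by linarith [hx.1]
  exact (ContDiffAt.mul (ContDiffAt.rpow_const_of_ne (by fun_prop) h1.ne')
    (ContDiffAt.rpow_const_of_ne (by fun_prop) h2.ne')).analyticAt

theorem hasDerivAt_iteratedDeriv_rodriguesWeight (s : ℝ) (j : ℕ) {x : ℝ}
    (hx : x ∈ Set.Ioo (-1 : ℝ) 1) :
    HasDerivAt (iteratedDeriv j (rodriguesWeight s))
      (iteratedDeriv (j + 1) (rodriguesWeight s) x) x := by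
  have h : AnalyticAt ℝ (iteratedDeriv j (rodriguesWeight s)) x := by
    rw [iteratedDeriv_eq_iterate]
    exact (analyticAt_rodriguesWeight s hx).iterated_deriv j
  rw [iteratedDeriv_succ]
  exact h.differentiableAt.hasDerivAt

theorem one_sub_sq_mul_deriv_rodriguesWeight (s : ℝ) {x : ℝ} (hx : x ∈ Set.Ioo (-1 : ℝ) 1) :
    (1 - x ^ 2) * iteratedDeriv 1 (rodriguesWeight s) x =
      -2 * s * x * iteratedDeriv 0 (rodriguesWeight s) x := by
  have h1 : 0 < 1 - x := by linarith [hx.2]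
  have h2 : 0 < 1 + x := by linarith [hx.1]
  have d1 : HasDerivAt (fun y : ℝ => (1 - y) ^ s) (-1 * s * (1 - x) ^ (s - 1)) x :=
    ((hasDerivAt_id x).const_sub 1).rpow_const (Or.inl h1.ne')
  have d2 : HasDerivAt (fun y : ℝ => (1 + y) ^ s) (1 * s * (1 + x) ^ (s - 1)) x :=
    ((hasDerivAt_id x).const_add 1).rpow_const (Or.inl h2.ne')
  have d : deriv (rodriguesWeight s) x = _ := (d1.mul d2).deriv
  rw [iteratedDeriv_one, iteratedDeriv_zero, d, rpow_sub_one h1.ne', rpow_sub_one h2.ne']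
  unfold rodriguesWeight
  field_simp
  ring

theorem iteratedDeriv_rodriguesWeight_recurrence (s : ℝ) (j : ℕ) {x : ℝ}
    (hx : x ∈ Set.Ioo (-1 : ℝ) 1) :
    (1 - x ^ 2) * iteratedDeriv (j + 2) (rodriguesWeight s) x =
      2 * (j + 1 - s) * x * iteratedDeriv (j + 1) (rodriguesWeight s) x +
        (j + 1) * (j - 2 * s) * iteratedDeriv j (rodriguesWeight s) x := by
  induction j generalizing x with
  | zero =>
    have hL := (((hasDerivAt_id x).pow 2).const_sub 1).mul
      (hasDerivAt_iteratedDeriv_rodriguesWeight s 1 hx)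
    have hR := (((hasDerivAt_id x).const_mul (-2 * s))).mul
      (hasDerivAt_iteratedDeriv_rodriguesWeight s 0 hx)
    have key := (hL.congr_of_eventuallyEq (f₁ := _) (Filter.eventuallyEq_of_mem
      (isOpen_Ioo.mem_nhds hx)
      (fun y hy => (one_sub_sq_mul_deriv_rodriguesWeight s hy).symm))).unique hR
    simp at key
    simp
    linarith
  | succ j ih =>
    have hL := (((hasDerivAt_id x).pow 2).const_sub 1).mul
      (hasDerivAt_iteratedDeriv_rodriguesWeight s (j + 2) hx)
    have hR := ((((hasDerivAt_id x).const_mul (2 * (j + 1 - s)))).mul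
      (hasDerivAt_iteratedDeriv_rodriguesWeight s (j + 1) hx)).add
      ((hasDerivAt_iteratedDeriv_rodriguesWeight s j hx).const_mul ((j + 1) * (j - 2 * s)))
    have key := (hL.congr_of_eventuallyEq (f₁ := _) (Filter.eventuallyEq_of_mem
      (isOpen_Ioo.mem_nhds hx) (fun y hy => (ih hy).symm))).unique hR
    simp at key
    push_cast
    linarith

theorem iteratedDeriv_rodriguesWeight_add_two_zero (s : ℝ) (j : ℕ) :
    iteratedDeriv (j + 2) (rodriguesWeight s) 0 =
      (j + 1) * (j - 2 * s) * iteratedDeriv j (rodriguesWeight s) 0 := by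
  simpa using iteratedDeriv_rodriguesWeight_recurrence s j (x := 0) (by norm_num)

theorem iteratedDeriv_rodriguesWeight_odd_zero (s : ℝ) (m : ℕ) :
    iteratedDeriv (2 * m + 1) (rodriguesWeight s) 0 = 0 := by
  induction m with
  | zero => simpa using one_sub_sq_mul_deriv_rodriguesWeight s (x := 0) (by norm_num)
  | succ m ih =>
    rw [show 2 * (m + 1) + 1 = 2 * m + 1 + 2 by ring,
      iteratedDeriv_rodriguesWeight_add_two_zero, ih, mul_zero]

theorem iteratedDeriv_rodriguesWeight_even_zero (s : ℝ) (m : ℕ) :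
    iteratedDeriv (2 * m) (rodriguesWeight s) 0 =
      (-1) ^ m * ((2 * m).factorial / m.factorial) * ∏ i ∈ Finset.range m, (s - i) := by
  induction m with
  | zero => simp [rodriguesWeight]
  | succ m ih =>
    rw [show 2 * (m + 1) = 2 * m + 2 by ring,
      iteratedDeriv_rodriguesWeight_add_two_zero, ih, Finset.prod_range_succ]
    simp only [Nat.factorial_succ]
    push_cast
    field_simp
    ring

/-- A Duhamel-type estimate for a perturbed harmonic oscillator. -/
theorem abs_sub_oscillator_le {N K T : ℝ} (hN : 0 < N) (hK : 0 < K) (hT : 0 ≤ T)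
    {u u' r : ℝ → ℝ}
    (hu : ∀ t ∈ Set.Icc 0 T, HasDerivAt u (u' t) t)
    (hu' : ∀ t ∈ Set.Icc 0 T, HasDerivAt u' (-N ^ 2 * u t + r t * u t) t)
    (hr : ∀ t ∈ Set.Icc 0 T, |r t| ≤ K * N) :
    |u T - (u 0 * cos (N * T) + u' 0 / N * sin (N * T))| ≤
      (|u 0| + |u' 0| / N) * (exp (K * T) - 1) := by
  set z : ℝ → ℂ := fun t =>
    ((u t : ℂ) + ((u' t / N : ℝ) : ℂ) * Complex.I) * Complex.exp ((N * t : ℝ) * Complex.I) with hz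
  set z' : ℝ → ℂ := fun t =>
    Complex.I * ((r t * u t / N : ℝ) : ℂ) * Complex.exp ((N * t : ℝ) * Complex.I) with hz'
  have hNc : (N : ℂ) ≠ 0 := by exact_mod_cast hN.ne'
  have hder : ∀ t ∈ Set.Icc 0 T, HasDerivAt z (z' t) t := by
    intro t ht
    have h1 := (hu t ht).ofReal_comp
    have h2 := (((hu' t ht).div_const N).ofReal_comp).mul_const Complex.I
    have h3 := ((((hasDerivAt_id t).const_mul N).ofReal_comp).mul_const Complex.I).cexp
    refine ((h1.add h2).mul h3).congr_deriv ?_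
    simp only [hz', id, mul_one, Pi.add_apply]
    push_cast
    field_simp
    linear_combination (u' t * N : ℂ) * Complex.I_sq
  have hnorm : ∀ t, ‖Complex.exp ((N * t : ℝ) * Complex.I)‖ = 1 :=
    fun t => Complex.norm_exp_ofReal_mul_I _
  have hzn : ∀ t, |u t| ≤ ‖z t‖ := by
    intro t
    rw [hz]
    simp only [norm_mul, hnorm, mul_one]
    simpa using Complex.abs_re_le_norm ((u t : ℂ) + ((u' t / N : ℝ) : ℂ) * Complex.I)
  have hz0 : ‖z 0‖ ≤ |u 0| + |u' 0| / N := by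
    rw [hz]
    simp only [norm_mul, hnorm, mul_one]
    refine (norm_add_le _ _).trans ?_
    simp [abs_of_pos hN]
  have hbound : ∀ t ∈ Set.Ico 0 T, ‖z' t‖ ≤ K * ‖z t - z 0‖ + K * ‖z 0‖ := by
    intro t ht
    have h1 : ‖z' t‖ = |r t| * |u t| / N := by
      rw [hz']
      simp only [norm_mul, hnorm, mul_one, Complex.norm_I, one_mul, Complex.norm_real,
        norm_eq_abs, abs_div, abs_mul, abs_of_pos hN]
    have h2 : |r t| * |u t| / N ≤ K * ‖z t‖ := by
      rw [div_le_iff₀ hN]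
      calc |r t| * |u t| ≤ (K * N) * ‖z t‖ :=
            mul_le_mul (hr t ⟨ht.1, ht.2.le⟩) (hzn t) (abs_nonneg _) (by positivity)
        _ = K * ‖z t‖ * N := by ring
    have h3 : ‖z t‖ ≤ ‖z t - z 0‖ + ‖z 0‖ := norm_le_norm_sub_add _ _
    rw [h1]
    nlinarith
  have hG := norm_le_gronwallBound_of_norm_deriv_right_le (f := fun t => z t - z 0) (f' := z')
    (δ := 0) (K := K) (ε := K * ‖z 0‖) (a := 0) (b := T)
    (fun t ht => ((hder t ht).sub_const (z 0)).continuousAt.continuousWithinAt)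
    (fun t ht => ((hder t ⟨ht.1, ht.2.le⟩).sub_const (z 0)).hasDerivWithinAt)
    (by simp) hbound T ⟨hT, le_rfl⟩
  rw [gronwallBound_of_K_ne_0 hK.ne'] at hG
  simp only [zero_mul, zero_add, sub_zero, mul_div_cancel_left₀ _ hK.ne'] at hG
  have hre : u T - (u 0 * cos (N * T) + u' 0 / N * sin (N * T)) =
      ((z T - z 0) * Complex.exp (-(N * T : ℝ) * Complex.I)).re := by
    have h0 : z 0 = (u 0 : ℂ) + ((u' 0 / N : ℝ) : ℂ) * Complex.I := by simp [hz]
    have hT' : z T * Complex.exp (-(N * T : ℝ) * Complex.I) =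
        (u T : ℂ) + ((u' T / N : ℝ) : ℂ) * Complex.I := by
      simp only [hz]
      rw [mul_assoc, ← Complex.exp_add]
      simp
    rw [sub_mul, hT', h0, ← Complex.ofReal_neg, Complex.exp_mul_I, ← Complex.ofReal_cos,
      ← Complex.ofReal_sin]
    simp [-Complex.ofReal_cos, -Complex.ofReal_sin, -Complex.ofReal_mul, -Complex.ofReal_neg,
      -Complex.ofReal_div]
  rw [hre]
  refine (Complex.abs_re_le_norm _).trans ?_
  rw [norm_mul, ← Complex.ofReal_neg, Complex.norm_exp_ofReal_mul_I, mul_one]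
  refine hG.trans (mul_le_mul_of_nonneg_right hz0 ?_)
  linarith [one_le_exp (show 0 ≤ K * T by positivity)]

theorem abs_sub_oscillator_le_symm {N K T : ℝ} (hN : 0 < N) (hK : 0 < K)
    {u u' r : ℝ → ℝ}
    (hu : ∀ t, |t| ≤ |T| → HasDerivAt u (u' t) t)
    (hu' : ∀ t, |t| ≤ |T| → HasDerivAt u' (-N ^ 2 * u t + r t * u t) t)
    (hr : ∀ t, |t| ≤ |T| → |r t| ≤ K * N) :
    |u T - (u 0 * cos (N * T) + u' 0 / N * sin (N * T))| ≤
      (|u 0| + |u' 0| / N) * (exp (K * |T|) - 1) := by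
  rcases le_total 0 T with hT | hT
  · have habs : ∀ t ∈ Set.Icc 0 T, |t| ≤ |T| := fun t ht => abs_le_abs_of_nonneg ht.1 ht.2
    rw [abs_of_nonneg hT]
    exact abs_sub_oscillator_le hN hK hT (fun t ht => hu t (habs t ht))
      (fun t ht => hu' t (habs t ht)) (fun t ht => hr t (habs t ht))
  · have habs : ∀ t ∈ Set.Icc 0 (-T), |-t| ≤ |T| := fun t ht => by
      rw [abs_neg, abs_of_nonpos hT, abs_of_nonneg ht.1]; exact ht.2
    have h := abs_sub_oscillator_le hN hK (neg_nonneg.2 hT) (u := fun t => u (-t))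
      (u' := fun t => -u' (-t)) (r := fun t => r (-t))
      (fun t ht => by
        simpa [Function.comp_def] using (hu (-t) (habs t ht)).scomp t (hasDerivAt_neg t))
      (fun t ht => by
        simpa [Function.comp_def] using ((hu' (-t) (habs t ht)).scomp t (hasDerivAt_neg t)).fun_neg)
      (fun t ht => hr _ (habs t ht))
    rw [abs_of_nonpos hT]
    simpa [neg_div] using h

/-- The normalised central value `4⁻ᵐ (α+2m choose m)` of a Jacobi polynomial. -/
noncomputable def centralValue (α : ℝ) (m : ℕ) : ℝ :=
  (∏ i ∈ Finset.range m, (α + 2 * m - i)) / (4 ^ m * m.factorial)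

/-- The sequence `a` satisfies `a m = 1 + O(1/m)`. -/
def NearOne (a : ℕ → ℝ) : Prop := ∃ A : ℝ, 0 ≤ A ∧ ∀ m : ℕ, 1 ≤ m → |a m - 1| ≤ A / m

theorem NearOne.mul {a b : ℕ → ℝ} (ha : NearOne a) (hb : NearOne b) :
    NearOne (fun m => a m * b m) := by
  obtain ⟨A, hA, ha⟩ := ha
  obtain ⟨B, hB, hb⟩ := hb
  refine ⟨A + B + A * B, by positivity, fun m hm => ?_⟩
  have hm' : (1 : ℝ) ≤ m := by exact_mod_cast hm
  have h : a m * b m - 1 = (a m - 1) + (b m - 1) + (a m - 1) * (b m - 1) := by ring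
  rw [h]
  calc _ ≤ |a m - 1| + |b m - 1| + |a m - 1| * |b m - 1| := by
        rw [← abs_mul]; exact abs_add_three _ _ _
    _ ≤ A / m + B / m + A / m * B := by
        have hB' : B / m ≤ B := div_le_self hB hm'
        gcongr
        · exact ha m hm
        · exact hb m hm
        · exact ha m hm
        · exact (hb m hm).trans hB'
    _ = (A + B + A * B) / m := by ring

theorem NearOne.comp_two_mul {a : ℕ → ℝ} (ha : NearOne a) : NearOne (fun m => a (2 * m)) := by
  obtain ⟨A, hA, ha⟩ := ha
  refine ⟨A, hA, fun m hm => (ha (2 * m) (by omega)).trans ?_⟩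
  have hm' : (1 : ℝ) ≤ m := by exact_mod_cast hm
  push_cast
  gcongr
  linarith

theorem nearOne_of_sq {a : ℕ → ℝ} (h0 : ∀ m, 0 ≤ a m) (ha : NearOne (fun m => a m ^ 2)) :
    NearOne a := by
  obtain ⟨A, hA, ha⟩ := ha
  refine ⟨A, hA, fun m hm => le_trans ?_ (ha m hm)⟩
  have h : a m ^ 2 - 1 = (a m - 1) * (a m + 1) := by ring
  rw [h, abs_mul]
  refine le_mul_of_one_le_right (abs_nonneg _) ?_
  rw [abs_of_nonneg] <;> linarith [h0 m]

theorem nearOne_div_add {p q : ℝ} (hq : 0 ≤ q) :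
    NearOne (fun m => (2 * m + p) / (2 * m + q)) := by
  refine ⟨|p - q| / 2, by positivity, fun m hm => ?_⟩
  have hm' : (1 : ℝ) ≤ m := by exact_mod_cast hm
  have hpos : 0 < 2 * m + q := by linarith
  rw [div_sub_one hpos.ne', abs_div, abs_of_pos hpos, div_div,
    show 2 * m + p - (2 * m + q) = p - q by ring]
  gcongr
  linarith

theorem nearOne_centralBinom :
    NearOne (fun m => √(π * m) * ((2 * m).factorial / (4 ^ m * (m.factorial : ℝ) ^ 2))) := by
  apply nearOne_of_sq (fun m => by positivity)
  refine ⟨1, by norm_num, fun m hm => ?_⟩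
  have hm' : (1 : ℝ) ≤ m := by exact_mod_cast hm
  have h1 := Real.Wallis.W_le m
  have h2 := Real.Wallis.le_W m
  have hW := Real.Wallis.W_eq_factorial_ratio m
  have hf1 : (0 : ℝ) < m.factorial := by exact_mod_cast m.factorial_pos
  have hf2 : (0 : ℝ) < (2 * m).factorial := by exact_mod_cast (2 * m).factorial_pos
  have hWp := Real.Wallis.W_pos m
  have key : (√(π * m) * ((2 * m).factorial / (4 ^ m * (m.factorial : ℝ) ^ 2))) ^ 2 =
      π * m / ((2 * m + 1) * Real.Wallis.W m) := by
    rw [mul_pow, sq_sqrt (by positivity), hW, show (2 : ℝ) ^ (4 * m) = (4 ^ m) ^ 2 by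
      rw [← pow_mul, mul_comm m 2, show (4 : ℝ) = 2 ^ 2 by norm_num, ← pow_mul]; ring_nf]
    field_simp
  simp only [key]
  rw [abs_le]
  have hpi := pi_pos
  constructor
  · have : 1 - 1 / (m : ℝ) ≤ π * m / ((2 * m + 1) * Real.Wallis.W m) := by
      rw [le_div_iff₀ (by positivity), one_sub_div (by positivity), div_mul_eq_mul_div,
        div_le_iff₀ (by positivity)]
      have h3 : ((m : ℝ) - 1) * ((2 * m + 1) * Real.Wallis.W m) ≤
          (m - 1) * ((2 * m + 1) * (π / 2)) := by
        have : (0 : ℝ) ≤ m - 1 := by linarith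
        gcongr
      nlinarith
    linarith
  · have : π * m / ((2 * m + 1) * Real.Wallis.W m) ≤ 1 + 1 / (m : ℝ) := by
      rw [div_le_iff₀ (by positivity)]
      have h3 : (1 + 1 / (m : ℝ)) * ((2 * m + 1) * ((2 * m + 1) / (2 * m + 2) * (π / 2))) ≤
          (1 + 1 / (m : ℝ)) * ((2 * m + 1) * Real.Wallis.W m) := by gcongr
      refine le_trans ?_ h3
      have : (1 + 1 / (m : ℝ)) * ((2 * m + 1) * ((2 * m + 1) / (2 * m + 2) * (π / 2))) =
        π * ((2 * m + 1) ^ 2 / (4 * m)) := by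
        field_simp
        ring
      rw [this]
      gcongr
      rw [le_div_iff₀ (by positivity)]
      nlinarith
    linarith

theorem prod_range_two_mul_sub (m : ℕ) :
    ∏ i ∈ Finset.range m, ((2 * m : ℝ) - i) = (2 * m).factorial / m.factorial := by
  rw [eq_div_iff (by positivity)]
  have h := Nat.factorial_mul_descFactorial (n := 2 * m) (k := m) (by omega)
  rw [show 2 * m - m = m by omega] at h
  rw [← h, Nat.descFactorial_eq_prod_range]
  push_cast
  rw [mul_comm]
  congr 1
  refine Finset.prod_congr rfl fun i hi => ?_
  rw [Nat.cast_sub (by have := Finset.mem_range.1 hi; omega)]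
  push_cast
  ring

theorem prod_range_add_one_sub (m : ℕ) (c : ℝ) :
    (∏ i ∈ Finset.range m, (c + 1 - i)) * (c + 1 - m) =
      (c + 1) * ∏ i ∈ Finset.range m, (c - i) := by
  rw [← Finset.prod_range_succ (fun i : ℕ => c + 1 - (i : ℝ)), Finset.prod_range_succ', mul_comm]
  congr 1
  · simp
  · refine Finset.prod_congr rfl fun i _ => ?_
    push_cast
    ring

theorem centralValue_add_one {α : ℝ} (hα : -1 < α) (m : ℕ) :
    centralValue (α + 1) m = (α + 2 * m + 1) / (α + m + 1) * centralValue α m := by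
  have h := prod_range_add_one_sub m (α + 2 * m)
  have hp : α + m + 1 ≠ 0 := by
    have : (0 : ℝ) ≤ m := m.cast_nonneg
    linarith
  unfold centralValue
  rw [div_mul_div_comm, div_eq_div_iff (by positivity) (by positivity), ← h,
    show ∏ i ∈ Finset.range m, (α + 1 + 2 * (m : ℝ) - i) =
      ∏ i ∈ Finset.range m, (α + 2 * (m : ℝ) + 1 - i) from
      Finset.prod_congr rfl fun i _ => by ring]
  ring

theorem centralValue_zero (m : ℕ) :
    centralValue 0 m = (2 * m).factorial / (4 ^ m * (m.factorial : ℝ) ^ 2) := by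
  unfold centralValue
  simp only [zero_add]
  rw [prod_range_two_mul_sub, div_div]
  ring

theorem centralValue_neg_half (m : ℕ) :
    centralValue (-1 / 2) m =
      (2 * (2 * m)).factorial / (4 ^ (2 * m) * ((2 * m).factorial : ℝ) ^ 2) := by
  have h : (∏ i ∈ Finset.range m, ((-1 / 2 : ℝ) + 2 * m - i)) *
      ∏ i ∈ Finset.range m, ((2 * m : ℝ) - i) =
      (∏ i ∈ Finset.range (2 * m), ((2 * (2 * m : ℕ) : ℝ) - i)) / 4 ^ m := by
    rw [← Finset.prod_mul_distrib, eq_div_iff (by positivity)]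
    have : ∀ M : ℕ, ∀ c : ℝ, (∏ i ∈ Finset.range M, ((-1 / 2 : ℝ) + c - i) * (c - i)) * 4 ^ M =
        ∏ i ∈ Finset.range (2 * M), (2 * c - i) := by
      intro M c
      induction M with
      | zero => simp
      | succ M ih =>
        rw [show 2 * (M + 1) = 2 * M + 1 + 1 by ring, Finset.prod_range_succ,
          Finset.prod_range_succ, Finset.prod_range_succ, ← ih]
        push_cast
        ring
    rw [this]
    push_cast
    rfl
  rw [prod_range_two_mul_sub, prod_range_two_mul_sub] at h
  unfold centralValue
  have hf1 : (m.factorial : ℝ) ≠ 0 := by positivity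
  have hf2 : ((2 * m).factorial : ℝ) ≠ 0 := by positivity
  field_simp at h ⊢
  rw [mul_comm 2 m, pow_mul, mul_comm m 2]
  linear_combination (4 : ℝ) ^ m * h

theorem nearOne_centralValue (n : ℕ) :
    NearOne (fun m => √(π * m) * centralValue ((n + 1 : ℕ) / 2 - 1) m /
      2 ^ (((n + 1 : ℕ) : ℝ) / 2 - 1)) := by
  induction n using Nat.twoStepInduction with
  | zero =>
    obtain ⟨A, hA, h⟩ := nearOne_centralBinom.comp_two_mul
    refine ⟨A, hA, fun m hm => ?_⟩
    convert h m hm using 3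
    beta_reduce
    rw [show (((0 + 1 : ℕ) : ℝ) / 2 - 1) = -1 / 2 by norm_num, centralValue_neg_half,
      show (-1 / 2 : ℝ) = -(1 / 2) by norm_num, rpow_neg (by norm_num), ← sqrt_eq_rpow,
      div_inv_eq_mul, mul_right_comm, ← sqrt_mul (by positivity)]
    push_cast
    ring_nf
  | one =>
    simpa [centralValue_zero] using nearOne_centralBinom
  | more n ih _ =>
    have hα : (-1 : ℝ) < ((n + 1 : ℕ) : ℝ) / 2 - 1 := by
      have : (0 : ℝ) < ((n + 1 : ℕ) : ℝ) / 2 := by positivity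
      linarith
    have e : (((n + 2 + 1 : ℕ) : ℝ) / 2 - 1) = (((n + 1 : ℕ) : ℝ) / 2 - 1) + 1 := by
      push_cast; ring
    rw [e]
    generalize ((n + 1 : ℕ) : ℝ) / 2 - 1 = α at *
    obtain ⟨A, hA, h⟩ := (nearOne_div_add (p := α + 1) (q := 2 * α + 2) (by linarith)).mul ih
    refine ⟨A, hA, fun m hm => ?_⟩
    convert h m hm using 3
    beta_reduce
    rw [centralValue_add_one hα, rpow_add_one (by norm_num)]
    have hp : α + m + 1 ≠ 0 := by
      have : (0 : ℝ) ≤ m := m.cast_nonneg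
      linarith
    have hp' : 2 * (m : ℝ) + (2 * α + 2) = 2 * (α + m + 1) := by ring
    rw [hp']
    have : (2 : ℝ) ^ α ≠ 0 := by positivity
    field_simp
    ring

/-- The constant in the Rodrigues formula. -/
noncomputable def rodriguesConst (k : ℕ) : ℝ := (-1) ^ k / (2 ^ k * (Nat.factorial k : ℝ))

theorem rodriguesConst_mul_even (α : ℝ) (m : ℕ) :
    rodriguesConst (2 * m) * iteratedDeriv (2 * m) (rodriguesWeight (α + (2 * m : ℕ))) 0 =
      (-1) ^ m * centralValue α m := by
  rw [iteratedDeriv_rodriguesWeight_even_zero]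
  unfold rodriguesConst centralValue
  rw [pow_mul, pow_mul]
  push_cast
  norm_num
  field_simp

theorem rodriguesConst_mul_odd (α : ℝ) (m : ℕ) :
    rodriguesConst (2 * m + 1) *
        iteratedDeriv (2 * m + 1 + 1) (rodriguesWeight (α + (2 * m + 1 : ℕ))) 0 =
      (-1) ^ m * (α + 2 * m + 1) * centralValue α m := by
  rw [show 2 * m + 1 + 1 = 2 * (m + 1) by ring, iteratedDeriv_rodriguesWeight_even_zero,
    Finset.prod_range_succ']
  have h : ∏ i ∈ Finset.range m, (α + (2 * m + 1 : ℕ) - ((i + 1 : ℕ) : ℝ)) =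
      ∏ i ∈ Finset.range m, (α + 2 * m - i) :=
    Finset.prod_congr rfl fun i _ => by push_cast; ring
  rw [h]
  unfold rodriguesConst centralValue
  rw [show 2 * (m + 1) = 2 * m + 1 + 1 by ring]
  simp only [Nat.factorial_succ (2 * m + 1), Nat.factorial_succ m, pow_succ, pow_mul]
  push_cast
  norm_num
  field_simp
  ring

theorem exists_centralAmplitude (n : ℕ) {α : ℝ} (hα : α = ((n + 1 : ℕ) : ℝ) / 2 - 1) :
    ∃ A : ℝ, 0 ≤ A ∧ ∀ k : ℕ, 2 ≤ k → ∃ ρ : ℝ, |ρ - 1| ≤ A / k ∧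
      rodriguesConst k * iteratedDeriv k (rodriguesWeight (α + k)) 0 =
        (√(π * k))⁻¹ * 2 ^ (α + 1 / 2) * ρ * cos (k * (π / 2)) ∧
      rodriguesConst k * iteratedDeriv (k + 1) (rodriguesWeight (α + k)) 0 / (k + α + 1 / 2) =
        (√(π * k))⁻¹ * 2 ^ (α + 1 / 2) * ρ * sin (k * (π / 2)) := by
  have hα' : -1 / 2 ≤ α := by
    have : (0 : ℝ) ≤ n := n.cast_nonneg
    rw [hα]; push_cast; linarith
  have h0 := nearOne_centralValue n
  rw [← hα] at h0
  have h1 : NearOne (fun m => √((2 * m + 1) / (2 * m + 0))) :=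
    nearOne_of_sq (fun m => sqrt_nonneg _) (by
      convert nearOne_div_add (p := 1) (q := 0) le_rfl using 2 with m
      have : (0 : ℝ) ≤ m := m.cast_nonneg
      exact sq_sqrt (div_nonneg (by linarith) (by linarith)))
  have h2 := nearOne_div_add (p := α + 1) (q := α + 3 / 2) (by linarith)
  obtain ⟨B, hB, hodd⟩ := (h1.mul h2).mul h0
  obtain ⟨A, hA, heven⟩ := h0
  have h2α : (2 : ℝ) ^ (α + 1 / 2) = 2 ^ α * √2 := by
    rw [rpow_add (by norm_num), sqrt_eq_rpow]
  have h2p : (2 : ℝ) ^ α ≠ 0 := by positivity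
  refine ⟨2 * A + 3 * B, by positivity, fun k hk => ?_⟩
  rcases Nat.even_or_odd' k with ⟨m, rfl | rfl⟩
  · have hm : 1 ≤ m := by omega
    have hm' : (1 : ℝ) ≤ m := by exact_mod_cast hm
    have hcos : cos ((2 * m : ℕ) * (π / 2)) = (-1) ^ m := by
      rw [← cos_nat_mul_pi]; push_cast; ring_nf
    have hsin : sin ((2 * m : ℕ) * (π / 2)) = 0 := by
      rw [← sin_nat_mul_pi m]; push_cast; ring_nf
    refine ⟨_, (heven m hm).trans ?_, ?_, ?_⟩
    · rw [div_le_div_iff₀ (by positivity) (by positivity)]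
      push_cast
      nlinarith [mul_nonneg hB (by positivity : (0 : ℝ) ≤ m)]
    · rw [rodriguesConst_mul_even, hcos, h2α]
      have hs : √(π * (2 * m : ℕ)) = √2 * √(π * m) := by
        rw [← sqrt_mul (by norm_num)]; push_cast; ring_nf
      have : √(π * m) ≠ 0 := by positivity
      rw [hs]
      field_simp
    · rw [iteratedDeriv_rodriguesWeight_odd_zero, hsin]
      simp
  · have hm : 1 ≤ m := by omega
    have hm' : (1 : ℝ) ≤ m := by exact_mod_cast hm
    have hcos : cos ((2 * m + 1 : ℕ) * (π / 2)) = 0 := by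
      rw [cos_eq_zero_iff]; exact ⟨m, by push_cast; ring⟩
    have hsin : sin ((2 * m + 1 : ℕ) * (π / 2)) = (-1) ^ m := by
      rw [← cos_nat_mul_pi, ← sin_add_pi_div_two]; push_cast; ring_nf
    refine ⟨_, (hodd m hm).trans ?_, ?_, ?_⟩
    · rw [div_le_div_iff₀ (by positivity) (by positivity)]
      push_cast
      nlinarith [mul_nonneg hA (by positivity : (0 : ℝ) ≤ m), mul_le_mul_of_nonneg_left hm' hB]
    · have h := iteratedDeriv_rodriguesWeight_odd_zero (α + (2 * m + 1 : ℕ)) m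
      rw [h, hcos]
      simp
    · rw [rodriguesConst_mul_odd, hsin, h2α]
      have hs : √((2 * (m : ℝ) + 1) / (2 * m + 0)) =
          √(π * (2 * m + 1 : ℕ)) / (√2 * √(π * m)) := by
        rw [← sqrt_mul (by norm_num), ← sqrt_div (by positivity)]
        congr 1
        push_cast
        field_simp
        ring
      have h3 : √(π * m) ≠ 0 := by positivity
      have h4 : √(π * (2 * m + 1 : ℕ)) ≠ 0 := by positivity
      have h5 : 2 * (m : ℝ) + (α + 3 / 2) ≠ 0 := by linarith
      have h6 : ((2 * m + 1 : ℕ) : ℝ) + α + 1 / 2 = 2 * (m : ℝ) + (α + 3 / 2) := by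
        push_cast; ring
      beta_reduce
      rw [hs, h6]
      field_simp
      ring

theorem jacobiP_self_sin (α : ℝ) (k : ℕ) {t : ℝ} (ht : |t| < π / 2) :
    jacobiP α α k (sin t) = cos t ^ (-(α + 1 / 2)) *
      (rodriguesConst k * (cos t ^ (1 / 2 - α) *
        iteratedDeriv k (rodriguesWeight (α + k)) (sin t))) := by
  have hc : 0 < cos t := cos_pos_of_mem_Ioo (abs_lt.1 ht)
  have h1 : (1 - sin t) ^ (-α) * (1 + sin t) ^ (-α) =
      cos t ^ (-(α + 1 / 2)) * cos t ^ (1 / 2 - α) := by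
    rw [← mul_rpow (by linarith [sin_le_one t]) (by linarith [neg_one_le_sin t]),
      show (1 - sin t) * (1 + sin t) = cos t ^ 2 by rw [cos_sq']; ring,
      ← rpow_natCast, ← rpow_mul hc.le, ← rpow_add hc]
    congr 1
    push_cast
    ring
  change rodriguesConst k * (1 - sin t) ^ (-α) * (1 + sin t) ^ (-α) *
    iteratedDeriv k (rodriguesWeight (α + k)) (sin t) = _
  linear_combination (rodriguesConst k * iteratedDeriv k (rodriguesWeight (α + k)) (sin t)) * h1

theorem abs_rodrigues_sub_oscillator_le {α N : ℝ} {k : ℕ} (hN : N = k + α + 1 / 2)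
    (hN0 : 0 < N) {T : ℝ} (hT : |T| < π / 2) :
    |cos T ^ (1 / 2 - α) * iteratedDeriv k (rodriguesWeight (α + k)) (sin T) -
        (iteratedDeriv k (rodriguesWeight (α + k)) 0 * cos (N * T) +
          iteratedDeriv (k + 1) (rodriguesWeight (α + k)) 0 / N * sin (N * T))| ≤
      (|iteratedDeriv k (rodriguesWeight (α + k)) 0| +
        |iteratedDeriv (k + 1) (rodriguesWeight (α + k)) 0| / N) *
      (exp ((|α ^ 2 - 1 / 4| + 1) / (N * cos T ^ 2) * |T|) - 1) := by
  set D : ℕ → ℝ → ℝ := fun j => iteratedDeriv j (rodriguesWeight (α + k))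
  have hcT : 0 < cos T := cos_pos_of_mem_Ioo (abs_lt.1 hT)
  have hcos : ∀ t, |t| ≤ |T| → 0 < cos t := fun t ht =>
    cos_pos_of_mem_Ioo (abs_lt.1 (ht.trans_lt hT))
  have hsin : ∀ t, |t| ≤ |T| → sin t ∈ Set.Ioo (-1 : ℝ) 1 := fun t ht => by
    have := hcos t ht
    have := sin_sq_add_cos_sq t
    constructor <;> nlinarith
  have hDd : ∀ j t, |t| ≤ |T| →
      HasDerivAt (fun t => D j (sin t)) (D (j + 1) (sin t) * cos t) t := fun j t ht =>
    (hasDerivAt_iteratedDeriv_rodriguesWeight (α + k) j (hsin t ht)).comp t (hasDerivAt_sin t)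
  have hpow : ∀ p t, |t| ≤ |T| →
      HasDerivAt (fun t => cos t ^ p) (-sin t * p * cos t ^ (p - 1)) t := fun p t ht =>
    (hasDerivAt_cos t).rpow_const (Or.inl (hcos t ht).ne')
  have key := abs_sub_oscillator_le_symm (N := N)
    (K := (|α ^ 2 - 1 / 4| + 1) / (N * cos T ^ 2)) (T := T) hN0 (by positivity)
    (u := fun t => cos t ^ (1 / 2 - α) * D k (sin t))
    (u' := fun t => -sin t * (1 / 2 - α) * cos t ^ (1 / 2 - α - 1) * D k (sin t) +
      cos t ^ (1 / 2 - α) * (D (k + 1) (sin t) * cos t))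
    (r := fun t => (α ^ 2 - 1 / 4) / cos t ^ 2)
    (fun t ht => (hpow _ t ht).mul (hDd k t ht))
    (fun t ht => by
      have hc := hcos t ht
      have hrec := iteratedDeriv_rodriguesWeight_recurrence (α + k) k (hsin t ht)
      rw [← cos_sq'] at hrec
      change cos t ^ 2 * D (k + 2) (sin t) = 2 * (k + 1 - (α + k)) * sin t * D (k + 1) (sin t) +
        (k + 1) * (k - 2 * (α + k)) * D k (sin t) at hrec
      have h := ((((hasDerivAt_sin t).neg.mul_const (1 / 2 - α)).mul
        (hpow (1 / 2 - α - 1) t ht)).mul (hDd k t ht)).add ((hpow (1 / 2 - α) t ht).mul ((hDd (k + 1) t ht).mul (hasDerivAt_cos t)))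
      refine h.congr_deriv ?_
      simp only [Pi.neg_apply, Pi.mul_apply, rpow_sub_one hc.ne']
      have hs : sin t ^ 2 = 1 - cos t ^ 2 := sin_sq t
      rw [hN]
      field_simp
      linear_combination (16 * cos t ^ 2) * hrec +
        (4 * (1 - 2 * α) * (-1 - 2 * α) * D k (sin t)) * hs)
    (fun t ht => by
      have hc := hcos t ht
      have hle : cos T ≤ cos t := by
        rw [← cos_abs T, ← cos_abs t]
        exact cos_le_cos_of_nonneg_of_le_pi (abs_nonneg _) (by linarith [pi_pos]) ht
      rw [abs_div, abs_of_pos (pow_pos hc 2), div_mul_eq_mul_div, mul_comm N,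
        mul_div_mul_right _ _ hN0.ne']
      gcongr
      linarith)
  simpa using key

theorem two_div_pi_mul_le_sin {c θ : ℝ} (h0 : 0 ≤ c) (h1 : c ≤ θ) (h2 : θ ≤ π - c) :
    2 / π * c ≤ sin θ := by
  have hpi := pi_pos
  rcases le_total θ (π / 2) with h | h
  · refine le_trans ?_ (mul_le_sin (h0.trans h1) h)
    gcongr
  · rw [← sin_pi_sub]
    refine le_trans ?_ (mul_le_sin (by linarith) (by linarith))
    gcongr
    linarith

theorem exp_sub_one_le_mul_exp (x : ℝ) : exp x - 1 ≤ x * exp x := by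
  have h := add_one_le_exp (-x)
  have h2 : exp (-x) * exp x = 1 := by rw [← exp_add]; simp
  nlinarith [exp_pos x]

theorem abs_jacobiP_sub_le {α N M A ρ : ℝ} {k : ℕ} (hN : N = k + α + 1 / 2) (hN0 : 0 < N)
    (hM : 0 ≤ M) (hA : 0 ≤ A) (hk : 1 ≤ k) (hρ : |ρ - 1| ≤ A / k)
    (heven : rodriguesConst k * iteratedDeriv k (rodriguesWeight (α + k)) 0 =
      M * ρ * cos (k * (π / 2)))
    (hodd : rodriguesConst k * iteratedDeriv (k + 1) (rodriguesWeight (α + k)) 0 / N =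
      M * ρ * sin (k * (π / 2)))
    {T : ℝ} (hT : |T| < π / 2) :
    |jacobiP α α k (sin T) - cos T ^ (-(α + 1 / 2)) * (M * cos (k * (π / 2) - N * T))| ≤
      cos T ^ (-(α + 1 / 2)) * (M * (2 * (1 + A) *
        (exp ((|α ^ 2 - 1 / 4| + 1) / (N * cos T ^ 2) * |T|) - 1) + A / k)) := by
  have hcT : 0 < cos T := cos_pos_of_mem_Ioo (abs_lt.1 hT)
  have hk' : (1 : ℝ) ≤ k := by exact_mod_cast hk
  have hosc := abs_rodrigues_sub_oscillator_le hN hN0 hT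
  rw [jacobiP_self_sin α k hT, ← mul_sub, abs_mul, abs_of_pos (rpow_pos_of_pos hcT _)]
  refine mul_le_mul_of_nonneg_left ?_ (rpow_pos_of_pos hcT _).le
  set c := rodriguesConst k
  set D₀ := iteratedDeriv k (rodriguesWeight (α + k)) 0
  set D₁ := iteratedDeriv (k + 1) (rodriguesWeight (α + k)) 0
  set u := cos T ^ (1 / 2 - α) * iteratedDeriv k (rodriguesWeight (α + k)) (sin T)
  set e := exp ((|α ^ 2 - 1 / 4| + 1) / (N * cos T ^ 2) * |T|) - 1
  have he : 0 ≤ e := sub_nonneg.2 (one_le_exp (by positivity))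
  have hρ1 : |ρ| ≤ 1 + A := by
    have h1 : |ρ| ≤ |ρ - 1| + 1 := by simpa using abs_add_le (ρ - 1) 1
    linarith [div_le_self hA hk']
  have hsplit : c * u - M * cos (k * (π / 2) - N * T) =
      c * (u - (D₀ * cos (N * T) + D₁ / N * sin (N * T))) +
        M * ((ρ - 1) * cos (k * (π / 2) - N * T)) := by
    rw [cos_sub]
    linear_combination cos (N * T) * heven + sin (N * T) * hodd
  have hamp : |c| * (|D₀| + |D₁| / N) ≤ M * (2 * (1 + A)) := by
    have h1 : |c| * (|D₀| + |D₁| / N) = |c * D₀| + |c * D₁ / N| := by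
      rw [abs_div, abs_mul, abs_mul, abs_of_pos hN0]; ring
    have hbd : ∀ x : ℝ, |x| ≤ 1 → |M * ρ * x| ≤ M * (1 + A) := fun x hx => by
      rw [abs_mul, abs_mul, abs_of_nonneg hM]
      exact (mul_le_of_le_one_right (by positivity) hx).trans (by gcongr)
    rw [h1, heven, hodd]
    linarith [hbd _ (abs_cos_le_one (k * (π / 2))), hbd _ (abs_sin_le_one (k * (π / 2)))]
  rw [hsplit]
  calc _ ≤ |c| * |u - (D₀ * cos (N * T) + D₁ / N * sin (N * T))| +
        M * (|ρ - 1| * |cos (k * (π / 2) - N * T)|) := by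
        refine (abs_add_le _ _).trans_eq ?_
        rw [abs_mul, abs_mul M, abs_mul (ρ - 1), abs_of_nonneg hM]
    _ ≤ |c| * ((|D₀| + |D₁| / N) * e) + M * (A / k * 1) := by
        gcongr
        exact abs_cos_le_one _
    _ ≤ M * (2 * (1 + A)) * e + M * (A / k * 1) := by
        rw [← mul_assoc]
        gcongr
    _ = _ := by ring

theorem ultraspherical_asymptotics (n : ℕ) (hn : 1 ≤ n) (C δ : ℝ)
    (hC : 0 < C) (hδ0 : 0 ≤ δ) (hδ1 : δ < 1 / 6) :
    ∃ (C' : ℝ) (k₀ : ℕ), 0 < C' ∧ ∀ k : ℕ, k₀ ≤ k → ∀ θ : ℝ,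
      C * (k : ℝ) ^ (-δ) < θ → θ < Real.pi - C * (k : ℝ) ^ (-δ) →
      |jacobiP ((n : ℝ) / 2 - 1) ((n : ℝ) / 2 - 1) k (Real.cos θ) -
          (Real.pi * k) ^ (-(1 : ℝ) / 2) *
            (Real.cos (θ / 2) * Real.sin (θ / 2)) ^ (-((n : ℝ) - 1) / 2) *
            Real.cos ((k : ℝ) * θ + (θ / 2 - Real.pi / 4) * ((n : ℝ) - 1))| ≤
        C' * (k : ℝ) ^ (-(3 : ℝ) / 2 + 6 * δ) * Real.sin θ ^ (-((n : ℝ) - 1) / 2) := by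
  obtain ⟨n, rfl⟩ : ∃ m, n = m + 1 := ⟨n - 1, by omega⟩
  obtain ⟨α, hα⟩ : ∃ α : ℝ, α = ((n + 1 : ℕ) : ℝ) / 2 - 1 := ⟨_, rfl⟩
  have hα' : 0 ≤ α + 1 / 2 := by
    have : (0 : ℝ) ≤ n := n.cast_nonneg
    rw [hα]; push_cast; linarith
  have hexp : -(((n + 1 : ℕ) : ℝ) - 1) / 2 = -(α + 1 / 2) := by rw [hα]; ring
  obtain ⟨A, hA, hamp⟩ := exists_centralAmplitude n hα
  set B := |α ^ 2 - 1 / 4| + 1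
  have hB0 : 0 < B := by positivity
  have hpi := pi_pos
  set E := B * (π / 2) / (2 / π * C) ^ 2 with hE
  have hE0 : 0 < E := by positivity
  refine ⟨2 ^ (α + 1 / 2) * (2 * (1 + A) * (E * exp E) + A), 2, by positivity,
    fun k hk θ hθ1 hθ2 => ?_⟩
  have hk' : (1 : ℝ) ≤ k := by exact_mod_cast (by omega : 1 ≤ k)
  have hk0 : (0 : ℝ) < k := by linarith
  obtain ⟨ρ, hρ, heven, hodd⟩ := hamp k hk
  have hCk : 0 < C * (k : ℝ) ^ (-δ) := by positivity
  have hsinθ := two_div_pi_mul_le_sin hCk.le hθ1.le hθ2.le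
  have hN0 : 0 < (k : ℝ) + α + 1 / 2 := by linarith
  set M := (√(π * k))⁻¹ * 2 ^ (α + 1 / 2) with hM
  have hT : |π / 2 - θ| < π / 2 := by
    rw [abs_lt]; constructor <;> linarith
  have main := abs_jacobiP_sub_le rfl hN0 (by positivity : 0 ≤ M) hA (by omega) hρ heven hodd hT
  rw [sin_pi_div_two_sub, cos_pi_div_two_sub] at main
  have hsin0 : 0 < sin θ := lt_of_lt_of_le (by positivity) hsinθ
  have hmainterm : (π * k) ^ (-(1 : ℝ) / 2) *
      (cos (θ / 2) * sin (θ / 2)) ^ (-(((n + 1 : ℕ) : ℝ) - 1) / 2) *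
      cos ((k : ℝ) * θ + (θ / 2 - π / 4) * (((n + 1 : ℕ) : ℝ) - 1)) =
      sin θ ^ (-(α + 1 / 2)) *
        (M * cos (k * (π / 2) - (k + α + 1 / 2) * (π / 2 - θ))) := by
    have h1 : cos (θ / 2) * sin (θ / 2) = sin θ * 2⁻¹ := by
      have := sin_two_mul (θ / 2)
      rw [mul_div_cancel₀ θ (by norm_num : (2 : ℝ) ≠ 0)] at this
      linarith
    rw [hexp, h1, mul_rpow hsin0.le (by norm_num), inv_rpow (by norm_num),
      rpow_neg (x := 2) (by norm_num) (α + 1 / 2), inv_inv,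
      show (-(1 : ℝ) / 2) = -(1 / 2) by ring, rpow_neg (by positivity), ← sqrt_eq_rpow,
      show (k : ℝ) * θ + (θ / 2 - π / 4) * (((n + 1 : ℕ) : ℝ) - 1) =
        k * (π / 2) - (k + α + 1 / 2) * (π / 2 - θ) by rw [hα]; ring]
    ring
  rw [hmainterm, hexp, ← hα]
  refine main.trans ?_
  rw [mul_comm (sin θ ^ (-(α + 1 / 2)))]
  refine mul_le_mul_of_nonneg_right ?_ (by positivity)
  have hpow : (k : ℝ) ^ (-(3 : ℝ) / 2 + 6 * δ) =
      (k : ℝ) ^ (-(1 : ℝ) / 2) * (k : ℝ) ^ (-1 + 6 * δ) := by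
    rw [← rpow_add hk0]; ring_nf
  have hMle : M ≤ 2 ^ (α + 1 / 2) * (k : ℝ) ^ (-(1 : ℝ) / 2) := by
    rw [hM, mul_comm, show (-(1 : ℝ) / 2) = -(1 / 2) by ring, rpow_neg hk0.le, ← sqrt_eq_rpow]
    gcongr
    nlinarith [pi_gt_three]
  have hAk : A / k ≤ A * (k : ℝ) ^ (-1 + 6 * δ) := by
    rw [div_eq_mul_inv, ← rpow_neg_one]
    gcongr
    linarith
  have hphase : B / ((k + α + 1 / 2) * sin θ ^ 2) * |π / 2 - θ| ≤
      E * (k : ℝ) ^ (-1 + 2 * δ) := by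
    have hkpow : (k : ℝ) * ((k : ℝ) ^ (-δ)) ^ 2 * (k : ℝ) ^ (-1 + 2 * δ) = 1 := by
      nth_rewrite 1 [← rpow_one (k : ℝ)]
      rw [← rpow_natCast, ← rpow_mul hk0.le, ← rpow_add hk0, ← rpow_add hk0]
      convert rpow_zero (k : ℝ) using 2
      push_cast
      ring
    have hEk : E * (k : ℝ) ^ (-1 + 2 * δ) =
        B / (k * (2 / π * (C * (k : ℝ) ^ (-δ))) ^ 2) * (π / 2) := by
      rw [hE]
      field_simp
      linear_combination hkpow
    rw [hEk]
    gcongr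
    linarith
  have hexpE : exp (B / ((k + α + 1 / 2) * sin θ ^ 2) * |π / 2 - θ|) - 1 ≤
      E * exp E * (k : ℝ) ^ (-1 + 6 * δ) := by
    refine (exp_sub_one_le_mul_exp _).trans ?_
    have h1 : (k : ℝ) ^ (-1 + 2 * δ) ≤ 1 := rpow_le_one_of_one_le_of_nonpos hk' (by linarith)
    have h2 : (k : ℝ) ^ (-1 + 2 * δ) ≤ (k : ℝ) ^ (-1 + 6 * δ) :=
      rpow_le_rpow_of_exponent_le hk' (by linarith)
    rw [mul_right_comm E]
    refine mul_le_mul (hphase.trans (by gcongr)) (exp_le_exp.2 ?_) (exp_pos _).le (by positivity)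
    exact hphase.trans (mul_le_of_le_one_right hE0.le h1)
  rw [hpow]
  calc _ ≤ (2 ^ (α + 1 / 2) * (k : ℝ) ^ (-(1 : ℝ) / 2)) *
        (2 * (1 + A) * (E * exp E * (k : ℝ) ^ (-1 + 6 * δ)) + A * (k : ℝ) ^ (-1 + 6 * δ)) := by
        have : 0 ≤ exp (B / ((k + α + 1 / 2) * sin θ ^ 2) * |π / 2 - θ|) - 1 :=
          sub_nonneg.2 (one_le_exp (by positivity))
        gcongr
    _ = _ := by ring
end
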